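/- arXiv:2406.09108 — 2 statements merged into one kernel-verified Lean document; each statement's English description precedes it below -/
import Mathlib

section
/- For every L > 0, ∫_0^∞ (1/t) · (1/(4√(πt))) · e^{−t/4} · e^{−L^2/(4t)} · (L/sinh(L/2)) dt = 1/(e^L − 1). -/
open MeasureTheory Real

lemma aux_phi_deriv (L t : ℝ) (ht : 0 < t) :
    HasDerivAt (fun t : ℝ => √t / 2 - L / (2 * √t)) (1 / 4 * (1 / √t + L / (t * √t))) t := by
  have hs : 0 < √t := Real.sqrt_pos.2 ht
  have h1 := Real.hasDerivAt_sqrt ht.ne'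
  have h2 := (h1.div_const 2).sub
    ((hasDerivAt_const t L).fun_div (h1.const_mul 2) (by positivity))
  refine h2.congr_deriv ?_
  have e : t = √t ^ 2 := (Real.sq_sqrt ht.le).symm
  generalize √t = s at *
  subst e
  field_simp
  ring

lemma aux_phi_inj (L : ℝ) (hL : 0 < L) :
    Set.InjOn (fun t : ℝ => √t / 2 - L / (2 * √t)) (Set.Ioi 0) := by
  refine StrictMonoOn.injOn ?_
  intro a ha b hb hab
  have ha' : 0 < √a := Real.sqrt_pos.2 ha
  have h : √a < √b := Real.sqrt_lt_sqrt (le_of_lt ha) hab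
  have : L / (2 * √b) < L / (2 * √a) := by gcongr
  show √a / 2 - L / (2 * √a) < √b / 2 - L / (2 * √b)
  linarith

lemma aux_phi_image (L : ℝ) (hL : 0 < L) :
    (fun t : ℝ => √t / 2 - L / (2 * √t)) '' (Set.Ioi 0) = Set.univ := by
  refine Set.eq_univ_of_forall fun y => ?_
  have hq : √(y ^ 2 + L) ^ 2 = y ^ 2 + L := Real.sq_sqrt (by positivity)
  have hlt : -y < √(y ^ 2 + L) := by
    apply Real.lt_sqrt_of_sq_lt
    nlinarith
  have hu : 0 < y + √(y ^ 2 + L) := by linarith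
  refine ⟨(y + √(y ^ 2 + L)) ^ 2, by simp only [Set.mem_Ioi]; positivity, ?_⟩
  simp only [Real.sqrt_sq hu.le]
  field_simp
  nlinarith

lemma aux_inv_image (L : ℝ) (hL : 0 < L) :
    (fun t : ℝ => L ^ 2 / t) '' (Set.Ioi 0) = Set.Ioi 0 := by
  ext y
  simp only [Set.mem_image, Set.mem_Ioi]
  constructor
  · rintro ⟨x, hx, rfl⟩
    positivity
  · intro hy
    exact ⟨L ^ 2 / y, by positivity, by field_simp⟩

lemma aux_KJ (L : ℝ) (hL : 0 < L) :
    (∫ t in Set.Ioi (0 : ℝ), 1 / √t * Real.exp (-(t / 4 + L ^ 2 / (4 * t))))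
      = L * ∫ t in Set.Ioi (0 : ℝ), 1 / (t * √t) * Real.exp (-(t / 4 + L ^ 2 / (4 * t))) := by
  have hd : ∀ x ∈ Set.Ioi (0 : ℝ),
      HasDerivWithinAt (fun t : ℝ => L ^ 2 / t) (-(L ^ 2 / x ^ 2)) (Set.Ioi 0) x := by
    intro x hx
    have hx' : x ≠ 0 := ne_of_gt hx
    have := (hasDerivAt_const x (L ^ 2)).fun_div (hasDerivAt_id x) hx'
    refine (this.congr_deriv ?_).hasDerivWithinAt
    simp
    ring
  have hinj : Set.InjOn (fun t : ℝ => L ^ 2 / t) (Set.Ioi 0) := by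
    intro a ha b hb hab
    have ha' : a ≠ 0 := ne_of_gt ha
    have hb' : b ≠ 0 := ne_of_gt hb
    have hL' := hL.ne'
    simp only at hab
    field_simp at hab
    exact hab.symm
  have key := integral_image_eq_integral_abs_deriv_smul measurableSet_Ioi hd hinj
    (fun t => 1 / √t * Real.exp (-(t / 4 + L ^ 2 / (4 * t))))
  rw [aux_inv_image L hL] at key
  rw [key, ← integral_const_mul]
  refine setIntegral_congr_fun measurableSet_Ioi fun t ht => ?_
  have ht : 0 < t := ht
  have hs : 0 < √t := Real.sqrt_pos.2 ht
  have e1 : √(L ^ 2 / t) = L / √t := by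
    rw [Real.sqrt_div (by positivity), Real.sqrt_sq hL.le]
  have e2 : L ^ 2 / t / 4 + L ^ 2 / (4 * (L ^ 2 / t)) = t / 4 + L ^ 2 / (4 * t) := by
    field_simp
    ring
  simp only [smul_eq_mul]
  rw [e1, e2, abs_neg, abs_of_pos (by positivity)]
  have e : t = √t ^ 2 := (Real.sq_sqrt ht.le).symm
  generalize Real.exp (-(t / 4 + L ^ 2 / (4 * t))) = E
  generalize √t = s at *
  subst e
  field_simp

lemma aux_exp (L t : ℝ) (ht : 0 < t) :
    Real.exp (-1 * (√t / 2 - L / (2 * √t)) ^ 2)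
      = Real.exp (L / 2) * Real.exp (-(t / 4 + L ^ 2 / (4 * t))) := by
  have hs : 0 < √t := Real.sqrt_pos.2 ht
  rw [← Real.exp_add]
  congr 1
  have e : t = √t ^ 2 := (Real.sq_sqrt ht.le).symm
  generalize √t = s at *
  subst e
  field_simp
  ring

lemma aux_J (L : ℝ) (hL : 0 < L) :
    (∫ t in Set.Ioi (0 : ℝ), 1 / (t * √t) * Real.exp (-(t / 4 + L ^ 2 / (4 * t))))
      = 2 * √π / L * Real.exp (-(L / 2)) := by
  have hd : ∀ x ∈ Set.Ioi (0 : ℝ), HasDerivWithinAt (fun t : ℝ => √t / 2 - L / (2 * √t))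
      (1 / 4 * (1 / √x + L / (x * √x))) (Set.Ioi 0) x :=
    fun x hx => (aux_phi_deriv L x hx).hasDerivWithinAt
  have key := integral_image_eq_integral_abs_deriv_smul measurableSet_Ioi hd (aux_phi_inj L hL)
    (fun y => Real.exp (-1 * y ^ 2))
  have keyI := (integrableOn_image_iff_integrableOn_abs_deriv_smul measurableSet_Ioi hd
    (aux_phi_inj L hL) (fun y => Real.exp (-1 * y ^ 2))).1
  rw [aux_phi_image L hL] at key keyI
  have hI := keyI (integrable_exp_neg_mul_sq one_pos).integrableOn
  rw [Measure.restrict_univ, integral_gaussian, div_one] at key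
  have hcongr : Set.EqOn (fun x : ℝ => |1 / 4 * (1 / √x + L / (x * √x))| •
      Real.exp (-1 * (√x / 2 - L / (2 * √x)) ^ 2))
      (fun t => Real.exp (L / 2) / 4 * (1 / √t * Real.exp (-(t / 4 + L ^ 2 / (4 * t))) +
        L * (1 / (t * √t) * Real.exp (-(t / 4 + L ^ 2 / (4 * t)))))) (Set.Ioi 0) := by
    intro t ht
    have ht : 0 < t := ht
    have hs : 0 < √t := Real.sqrt_pos.2 ht
    simp only [smul_eq_mul]
    rw [aux_exp L t ht, abs_of_pos (by positivity)]
    ring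
  rw [setIntegral_congr_fun measurableSet_Ioi hcongr, integral_const_mul] at key
  have hI2 := (integrableOn_congr_fun hcongr measurableSet_Ioi).1 hI
  have hI3 : IntegrableOn (fun t => (1 / √t * Real.exp (-(t / 4 + L ^ 2 / (4 * t))) +
        L * (1 / (t * √t) * Real.exp (-(t / 4 + L ^ 2 / (4 * t)))))) (Set.Ioi 0) := by
    have := hI2.const_mul (Real.exp (L / 2) / 4)⁻¹
    refine this.congr (Filter.Eventually.of_forall fun t => ?_)
    have : Real.exp (L / 2) / 4 ≠ 0 := by positivity
    simp only
    rw [inv_mul_cancel_left₀ this]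
  have hK : IntegrableOn (fun t => 1 / √t * Real.exp (-(t / 4 + L ^ 2 / (4 * t))))
      (Set.Ioi 0) := by
    refine Integrable.mono' hI3 (Measurable.aestronglyMeasurable (by fun_prop)) ?_
    filter_upwards [ae_restrict_mem measurableSet_Ioi] with t ht
    have ht : 0 < t := ht
    rw [Real.norm_of_nonneg (by positivity)]
    exact le_add_of_nonneg_right (by positivity)
  have hJ : IntegrableOn (fun t => L * (1 / (t * √t) * Real.exp (-(t / 4 + L ^ 2 / (4 * t)))))
      (Set.Ioi 0) := by
    refine Integrable.mono' hI3 (Measurable.aestronglyMeasurable (by fun_prop)) ?_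
    filter_upwards [ae_restrict_mem measurableSet_Ioi] with t ht
    have ht : 0 < t := ht
    rw [Real.norm_of_nonneg (by positivity)]
    exact le_add_of_nonneg_left (by positivity)
  rw [integral_add hK hJ, integral_const_mul, aux_KJ L hL] at key
  rw [key, Real.exp_neg]
  have := Real.exp_pos (L / 2)
  generalize (∫ t in Set.Ioi (0 : ℝ), 1 / (t * √t) *
    Real.exp (-(t / 4 + L ^ 2 / (4 * t)))) = J
  field_simp
  ring

/-- For every `L > 0`,
`∫_0^∞ (1/t) · (1/(4√(πt))) · e^{−t/4} · e^{−L²/(4t)} · (L/sinh(L/2)) dt = 1/(e^L − 1)`. -/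
theorem integral_time_heat_trace (L : ℝ) (hL : 0 < L) :
    (∫ t in Set.Ioi (0 : ℝ),
        (1 / t) * (1 / (4 * Real.sqrt (Real.pi * t))) * Real.exp (-t / 4) *
          Real.exp (-L ^ 2 / (4 * t)) * (L / Real.sinh (L / 2)))
      = 1 / (Real.exp L - 1) := by
  have hc : Set.EqOn (fun t : ℝ => (1 / t) * (1 / (4 * Real.sqrt (Real.pi * t))) *
      Real.exp (-t / 4) * Real.exp (-L ^ 2 / (4 * t)) * (L / Real.sinh (L / 2)))
      (fun t => (1 / (4 * √π) * (L / Real.sinh (L / 2))) *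
        (1 / (t * √t) * Real.exp (-(t / 4 + L ^ 2 / (4 * t))))) (Set.Ioi 0) := by
    intro t ht
    have e : Real.exp (-(t / 4 + L ^ 2 / (4 * t)))
        = Real.exp (-t / 4) * Real.exp (-L ^ 2 / (4 * t)) := by
      rw [← Real.exp_add]
      congr 1
      ring
    simp only
    rw [e, Real.sqrt_mul Real.pi_pos.le]
    simp only [one_div, mul_inv]
    ring
  rw [setIntegral_congr_fun measurableSet_Ioi hc, integral_const_mul, aux_J L hL,
    Real.sinh_eq]
  have hp : 0 < √π := Real.sqrt_pos.2 Real.pi_pos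
  have h1 : 1 < Real.exp (L / 2) := Real.one_lt_exp_iff.2 (by positivity)
  have h2 : Real.exp L = Real.exp (L / 2) ^ 2 := by
    rw [← Real.exp_nat_mul]
    congr 1
    push_cast
    ring
  rw [h2, Real.exp_neg]
  generalize Real.exp (L / 2) = x at *
  have h3 : x ^ 2 - 1 ≠ 0 := by nlinarith
  have h0 : x ≠ 0 := by linarith
  have h4 : x - x⁻¹ = (x ^ 2 - 1) / x := by field_simp
  rw [h4]
  field_simp
  norm_num
end

section
/- Let (ℓ_n)_{n∈ℕ} be a sequence of positive real numbers, and suppose there exist constants C > 0 and δ ∈ (0,1) such that for every L > 0 the set {n ∈ ℕ : ℓ_n ≤ L} is finite with cardinality at most C e^{δL}. Then the double series ∑_{n∈ℕ} ∑_{m=1}^∞ (1/m) · 1/(e^{m ℓ_n} − 1) converges (the family ((1/m)·1/(e^{m ℓ_n}−1))_{(n,m)} is summable). -/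
open Real

lemma aux_summable_exp (ℓ : ℕ → ℝ) (hpos : ∀ n, 0 < ℓ n)
    (C δ : ℝ) (hδ1 : δ < 1) (hC : 0 < C)
    (hcount : ∀ L : ℝ, 0 < L → {n : ℕ | ℓ n ≤ L}.Finite ∧
      (Nat.card {n : ℕ // ℓ n ≤ L} : ℝ) ≤ C * Real.exp (δ * L)) :
    Summable (fun n => Real.exp (-ℓ n)) := by
  have hg : Summable (fun k : ℕ => C * Real.exp δ * Real.exp (k * (δ - 1))) :=
    (Real.summable_exp_nat_mul_iff.mpr (by linarith)).mul_left _
  refine summable_of_sum_le (c := ∑' k : ℕ, C * Real.exp δ * Real.exp (k * (δ - 1)))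
    (fun n => (Real.exp_pos _).le) (fun u => ?_)
  rw [← Finset.sum_fiberwise_of_maps_to (t := u.image (fun n => ⌊ℓ n⌋₊))
    (g := fun n => ⌊ℓ n⌋₊) (fun n hn => Finset.mem_image_of_mem _ hn)]
  refine le_trans (Finset.sum_le_sum (fun k _ => ?_))
    (hg.sum_le_tsum _ (fun k _ => by positivity))
  obtain ⟨hfin, hcard⟩ := hcount ((k : ℝ) + 1) (by positivity)
  have h1 : ∑ n ∈ u with ⌊ℓ n⌋₊ = k, Real.exp (-ℓ n) ≤
      (u.filter (fun n => ⌊ℓ n⌋₊ = k)).card • Real.exp (-(k : ℝ)) := by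
    refine Finset.sum_le_card_nsmul _ _ _ (fun n hn => ?_)
    have h := (Finset.mem_filter.mp hn).2
    have := Nat.floor_le (hpos n).le
    rw [h] at this
    exact Real.exp_le_exp.mpr (by linarith)
  have h2 : ((u.filter (fun n => ⌊ℓ n⌋₊ = k)).card : ℝ) ≤ C * Real.exp (δ * (k + 1)) := by
    refine le_trans ?_ hcard
    have h3 : Nat.card {n : ℕ // ℓ n ≤ (k : ℝ) + 1} = hfin.toFinset.card := by
      rw [← Set.ncard_eq_toFinset_card _ hfin]; rfl
    rw [h3]
    exact_mod_cast Finset.card_le_card (fun n hn => by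
      have h := (Finset.mem_filter.mp hn).2
      have := Nat.lt_floor_add_one (ℓ n)
      rw [h] at this
      simpa using this.le)
  refine h1.trans ?_
  rw [nsmul_eq_mul]
  refine (mul_le_mul_of_nonneg_right h2 (Real.exp_pos _).le).trans (le_of_eq ?_)
  rw [mul_assoc, mul_assoc, ← Real.exp_add, ← Real.exp_add]
  ring_nf

/-- If the positive sequence `(ℓ_n)` satisfies the counting bound
`#{n : ℓ_n ≤ L} ≤ C e^{δL}` with `δ < 1`, then the family
`((1/m) · 1/(e^{m ℓ_n} − 1))_{n ∈ ℕ, m ≥ 1}` is summable. -/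
theorem summable_loop_mass_of_counting_bound (ℓ : ℕ → ℝ) (hpos : ∀ n, 0 < ℓ n)
    (C δ : ℝ) (hC : 0 < C) (hδ0 : 0 < δ) (hδ1 : δ < 1)
    (hcount : ∀ L : ℝ, 0 < L → {n : ℕ | ℓ n ≤ L}.Finite ∧
      (Nat.card {n : ℕ // ℓ n ≤ L} : ℝ) ≤ C * Real.exp (δ * L)) :
    Summable (fun p : ℕ × ℕ =>
      (1 / ((p.2 : ℝ) + 1)) * (1 / (Real.exp (((p.2 : ℝ) + 1) * ℓ p.1) - 1))) := by
  have hs := aux_summable_exp ℓ hpos C δ hδ1 hC hcount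
  obtain ⟨ε, hε, hmin⟩ : ∃ ε : ℝ, 0 < ε ∧ ∀ n, ε ≤ ℓ n := by
    obtain ⟨hfin, -⟩ := hcount 1 one_pos
    rcases Set.eq_empty_or_nonempty {n : ℕ | ℓ n ≤ 1} with he | hne
    · refine ⟨1, one_pos, fun n => ?_⟩
      by_contra! h
      have : n ∈ {n : ℕ | ℓ n ≤ 1} := h.le
      simp [he] at this
    · obtain ⟨a, ha, hmin⟩ := Set.exists_min_image _ ℓ hfin hne
      refine ⟨ℓ a, hpos a, fun n => ?_⟩
      by_cases h : ℓ n ≤ 1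
      · exact hmin n h
      · exact le_trans ha (not_le.mp h).le
  have hq : 0 < 1 - Real.exp (-ε) := by
    have : Real.exp (-ε) < 1 := by rw [← Real.exp_zero]; exact Real.exp_lt_exp.mpr (by linarith)
    linarith
  have hgeo : Summable (fun k : ℕ => Real.exp (k * (-ε))) :=
    Real.summable_exp_nat_mul_iff.mpr (by linarith)
  have hprod := (hs.mul_of_nonneg hgeo (fun n => (Real.exp_pos _).le)
    (fun n => (Real.exp_pos _).le)).mul_left (1 / (1 - Real.exp (-ε)))
  refine Summable.of_nonneg_of_le (fun p => ?_) (fun p => ?_) hprod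
  · have : 1 ≤ Real.exp (((p.2 : ℝ) + 1) * ℓ p.1) :=
      Real.one_le_exp (mul_nonneg (by positivity) (hpos _).le)
    exact mul_nonneg (by positivity) (one_div_nonneg.mpr (by linarith))
  · obtain ⟨n, m⟩ := p
    simp only
    have hl := hmin n
    have hm : (0 : ℝ) ≤ m := Nat.cast_nonneg m
    set x := ((m : ℝ) + 1) * ℓ n with hx
    have hεx : ε ≤ x := by nlinarith
    have hlow : (1 - Real.exp (-ε)) * Real.exp x ≤ Real.exp x - 1 := by
      have : 1 ≤ Real.exp (-ε) * Real.exp x := by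
        rw [← Real.exp_add]; exact Real.one_le_exp (by linarith)
      linarith
    have hA : 0 < (1 - Real.exp (-ε)) * Real.exp x := mul_pos hq (Real.exp_pos _)
    have hm1 : 1 / ((m : ℝ) + 1) ≤ 1 := by
      rw [div_le_one (by positivity)]; linarith
    calc 1 / ((m : ℝ) + 1) * (1 / (Real.exp x - 1))
        ≤ 1 * (1 / ((1 - Real.exp (-ε)) * Real.exp x)) :=
          mul_le_mul hm1 (one_div_le_one_div_of_le hA hlow)
            (one_div_nonneg.mpr (by linarith)) zero_le_one
      _ = 1 / (1 - Real.exp (-ε)) * Real.exp (-x) := by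
          rw [Real.exp_neg x]; field_simp
      _ ≤ 1 / (1 - Real.exp (-ε)) * (Real.exp (-ℓ n) * Real.exp (m * (-ε))) := by
          refine mul_le_mul_of_nonneg_left ?_ (one_div_nonneg.mpr hq.le)
          rw [← Real.exp_add]
          exact Real.exp_le_exp.mpr (by rw [hx]; nlinarith)
end
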